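/- For every positive integer m, the bipartite achievement number of the matching with m edges satisfies ba(mK_2) = m + 1 if m = 2 or m = 3, and ba(mK_2) = m if m = 1 or m ≥ 4. -/

import Mathlib

namespace AchievementGame

/-- A strategy for the achievement game: given the history of all moves played so far
(earliest first), produce the next move (an edge, i.e. an element of `Sym2`). -/
def Strategy (α : Type*) : Type _ := List (Sym2 α) → Sym2 α

/-- A strategy is valid for the host graph `G` if, whenever some edge of `G` is still
uncolored, it chooses an uncolored edge of `G`. -/
def Strategy.Valid {α : Type*} (G : SimpleGraph α) (s : Strategy α) : Prop :=
  ∀ l : List (Sym2 α), (∃ e ∈ G.edgeSet, e ∉ l) → s l ∈ G.edgeSet ∧ s l ∉ l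

/-- The history of the first `n` moves when Alice plays strategy `σ` and Bob plays
strategy `τ`; Alice moves first and the players alternate. -/
def hist {α : Type*} (σ τ : Strategy α) : ℕ → List (Sym2 α)
  | 0 => []
  | n + 1 => hist σ τ n ++ [(if n % 2 = 0 then σ else τ) (hist σ τ n)]

/-- The `n`-th move (0-indexed): even indices are Alice's (blue) moves,
odd indices are Bob's (red) moves. -/
def move {α : Type*} (σ τ : Strategy α) (n : ℕ) : Sym2 α :=
  (if n % 2 = 0 then σ else τ) (hist σ τ n)

/-- The set `s` of edges contains a copy of the graph `F`. -/
def HasCopy {α β : Type*} (F : SimpleGraph β) (s : Set (Sym2 α)) : Prop :=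
  ∃ f : β ↪ α, ∀ a b, F.Adj a b → s(f a, f b) ∈ s

/-- Alice has a winning strategy in the achievement game `(F, G, +)`: Alice has a valid
strategy such that against every valid strategy of Bob, at some legal move of Alice
(her `(k+1)`-st move, which exists since `2k+1 ≤ |E(G)|`) the blue edges contain a copy
of `F`, while the red edges played strictly before do not. -/
def AliceWins {α β : Type*} (F : SimpleGraph β) (G : SimpleGraph α) : Prop :=
  ∃ σ : Strategy α, Strategy.Valid G σ ∧ ∀ τ : Strategy α, Strategy.Valid G τ →
    ∃ k : ℕ, 2 * k + 1 ≤ G.edgeSet.ncard ∧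
      HasCopy F {e | ∃ i ≤ k, e = move σ τ (2 * i)} ∧
      ¬ HasCopy F {e | ∃ i < k, e = move σ τ (2 * i + 1)}

/-- The matching `mK₂` consisting of `m` pairwise disjoint edges. -/
def matching (m : ℕ) : SimpleGraph (Fin m ⊕ Fin m) :=
  SimpleGraph.fromRel (fun a b => ∃ i, a = Sum.inl i ∧ b = Sum.inr i)

/-- The star `K_{1,m}`: the center `0` joined to `m` leaves. -/
def star (m : ℕ) : SimpleGraph (Fin (m + 1)) :=
  SimpleGraph.fromRel (fun a _ => a = 0)

/-- The double star `S_{m,n}`: disjoint stars `K_{1,m}` and `K_{1,n}` with an edge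
joining their centers `Sum.inl 0` and `Sum.inr 0`. -/
def doubleStar (m n : ℕ) : SimpleGraph (Fin (m + 1) ⊕ Fin (n + 1)) :=
  SimpleGraph.fromRel (fun a b =>
    (a = Sum.inl 0 ∧ ∃ i, b = Sum.inl i) ∨
    (a = Sum.inr 0 ∧ ∃ j, b = Sum.inr j) ∨
    (a = Sum.inl 0 ∧ b = Sum.inr 0))

/-- The disjoint union `K_{1,m} ∪ nK₂` of a star and a matching. -/
def starMatching (m n : ℕ) : SimpleGraph (Fin (m + 1) ⊕ (Fin n ⊕ Fin n)) :=
  SimpleGraph.fromRel (fun a b =>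
    (a = Sum.inl 0 ∧ ∃ i, b = Sum.inl i) ∨
    (∃ i, a = Sum.inr (Sum.inl i) ∧ b = Sum.inr (Sum.inr i)))

end AchievementGame

open AchievementGame


section General
variable {n : ℕ}

/-- The edge of `K_{n,n}` with coordinates `e`. -/
def edgeOf (e : Fin n × Fin n) : Sym2 (Fin n ⊕ Fin n) := s(Sum.inl e.1, Sum.inr e.2)

lemma edgeOf_inj : Function.Injective (edgeOf (n := n)) := by
  rintro ⟨a, b⟩ ⟨c, d⟩ h
  simp only [edgeOf, Sym2.eq_iff] at h
  aesop

lemma mem_edgeSet_iff (x : Sym2 (Fin n ⊕ Fin n)) :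
    x ∈ (completeBipartiteGraph (Fin n) (Fin n)).edgeSet ↔ ∃ e, x = edgeOf e := by
  induction x using Sym2.ind with
  | _ u v =>
    rw [SimpleGraph.mem_edgeSet]
    rcases u with u | u <;> rcases v with v | v <;>
      simp [edgeOf, completeBipartiteGraph]

/-- The set of cells contains a matching of size `m`. -/
def HasM (m : ℕ) (S : Finset (Fin n × Fin n)) : Prop :=
  ∃ f g : Fin m → Fin n, Function.Injective f ∧ Function.Injective g ∧ ∀ i, (f i, g i) ∈ S

lemma hasCopy_iff (m : ℕ) (S : Finset (Fin n × Fin n)) :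
    HasCopy (matching m) (edgeOf '' (S : Set (Fin n × Fin n))) ↔ HasM m S := by
  constructor
  · rintro ⟨f, hf⟩
    have h1 : ∀ i : Fin m, ∃ e : Fin n × Fin n, e ∈ S ∧
        edgeOf e = s(f (Sum.inl i), f (Sum.inr i)) := by
      intro i
      have := hf (Sum.inl i) (Sum.inr i) (by simp [matching])
      simpa using this
    choose e he1 he2 using h1
    have key : ∀ i, (f (Sum.inl i) = Sum.inl (e i).1 ∧ f (Sum.inr i) = Sum.inr (e i).2) ∨
        (f (Sum.inr i) = Sum.inl (e i).1 ∧ f (Sum.inl i) = Sum.inr (e i).2) := by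
      intro i
      have := he2 i
      simp only [edgeOf, Sym2.eq_iff] at this
      rcases this with ⟨h, h'⟩ | ⟨h, h'⟩
      · exact Or.inl ⟨h.symm, h'.symm⟩
      · exact Or.inr ⟨h.symm, h'.symm⟩
    refine ⟨fun i => (e i).1, fun i => (e i).2, ?_, ?_, fun i => he1 i⟩
    · intro i j hij
      simp only at hij
      rcases key i with ⟨a, b⟩ | ⟨a, b⟩ <;> rcases key j with ⟨c, d⟩ | ⟨c, d⟩ <;>
        · rw [hij, ← c] at a
          simpa using f.injective a
    · intro i j hij
      simp only at hij
      rcases key i with ⟨a, b⟩ | ⟨a, b⟩ <;> rcases key j with ⟨c, d⟩ | ⟨c, d⟩ <;>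
        · rw [hij, ← d] at b
          simpa using f.injective b
  · rintro ⟨f, g, hf, hg, h⟩
    refine ⟨⟨Sum.map f g, hf.sumMap hg⟩, ?_⟩
    rintro (a | a) (b | b) hab
    · simp [matching] at hab
    · simp [matching] at hab
      subst hab
      exact ⟨(f b, g b), by simpa using h b, rfl⟩
    · simp [matching] at hab
      subst hab
      exact ⟨(f a, g a), by simpa using h a, Sym2.eq_swap⟩
    · simp [matching] at hab

open Classical in
/-- Blue cells of a history. -/
noncomputable def blueOf (l : List (Sym2 (Fin n ⊕ Fin n))) : Finset (Fin n × Fin n) :=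
  Finset.univ.filter fun e => ∃ i, l[2 * i]? = some (edgeOf e)

open Classical in
/-- Red cells of a history. -/
noncomputable def redOf (l : List (Sym2 (Fin n ⊕ Fin n))) : Finset (Fin n × Fin n) :=
  Finset.univ.filter fun e => ∃ i, l[2 * i + 1]? = some (edgeOf e)

lemma mem_list_iff (l : List (Sym2 (Fin n ⊕ Fin n))) (e : Fin n × Fin n) :
    edgeOf e ∈ l ↔ e ∈ blueOf l ∨ e ∈ redOf l := by
  simp only [blueOf, redOf, Finset.mem_filter, Finset.mem_univ, true_and]
  rw [List.mem_iff_getElem?]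
  constructor
  · rintro ⟨i, hi⟩
    rcases Nat.even_or_odd' i with ⟨k, rfl | rfl⟩
    · exact Or.inl ⟨k, hi⟩
    · exact Or.inr ⟨k, hi⟩
  · rintro (⟨i, hi⟩ | ⟨i, hi⟩)
    · exact ⟨_, hi⟩
    · exact ⟨_, hi⟩

lemma blueOf_append_even (l : List (Sym2 (Fin n ⊕ Fin n))) (e : Fin n × Fin n) {k : ℕ}
    (hl : l.length = 2 * k) :
    blueOf (l ++ [edgeOf e]) = insert e (blueOf l) ∧ redOf (l ++ [edgeOf e]) = redOf l := by
  constructor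
  · ext x
    simp only [blueOf, Finset.mem_filter, Finset.mem_univ, true_and, Finset.mem_insert]
    constructor
    · rintro ⟨i, hi⟩
      rcases lt_trichotomy i k with h | h | h
      · rw [List.getElem?_append_left (by omega)] at hi
        exact Or.inr ⟨i, hi⟩
      · subst h
        rw [← hl] at hi
        simp at hi
        exact Or.inl (edgeOf_inj hi).symm
      · rw [List.getElem?_eq_none (by simp; omega)] at hi
        simp at hi
    · rintro (rfl | ⟨i, hi⟩)
      · exact ⟨k, by rw [← hl]; simp⟩
      · refine ⟨i, ?_⟩
        have := (List.getElem?_eq_some_iff.1 hi).1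
        rw [List.getElem?_append_left this, hi]
  · ext x
    simp only [redOf, Finset.mem_filter, Finset.mem_univ, true_and]
    constructor
    · rintro ⟨i, hi⟩
      rcases lt_or_ge i k with h | h
      · rw [List.getElem?_append_left (by omega)] at hi
        exact ⟨i, hi⟩
      · rw [List.getElem?_eq_none (by simp; omega)] at hi
        simp at hi
    · rintro ⟨i, hi⟩
      refine ⟨i, ?_⟩
      have := (List.getElem?_eq_some_iff.1 hi).1
      rw [List.getElem?_append_left this, hi]

lemma redOf_append_odd (l : List (Sym2 (Fin n ⊕ Fin n))) (e : Fin n × Fin n) {k : ℕ}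
    (hl : l.length = 2 * k + 1) :
    blueOf (l ++ [edgeOf e]) = blueOf l ∧ redOf (l ++ [edgeOf e]) = insert e (redOf l) := by
  constructor
  · ext x
    simp only [blueOf, Finset.mem_filter, Finset.mem_univ, true_and]
    constructor
    · rintro ⟨i, hi⟩
      rcases lt_or_ge i (k + 1) with h | h
      · rw [List.getElem?_append_left (by omega)] at hi
        exact ⟨i, hi⟩
      · rw [List.getElem?_eq_none (by simp; omega)] at hi
        simp at hi
    · rintro ⟨i, hi⟩
      refine ⟨i, ?_⟩
      have := (List.getElem?_eq_some_iff.1 hi).1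
      rw [List.getElem?_append_left this, hi]
  · ext x
    simp only [redOf, Finset.mem_filter, Finset.mem_univ, true_and, Finset.mem_insert]
    constructor
    · rintro ⟨i, hi⟩
      rcases lt_trichotomy i k with h | h | h
      · rw [List.getElem?_append_left (by omega)] at hi
        exact Or.inr ⟨i, hi⟩
      · subst h
        rw [← hl] at hi
        simp at hi
        exact Or.inl (edgeOf_inj hi).symm
      · rw [List.getElem?_eq_none (by simp; omega)] at hi
        simp at hi
    · rintro (rfl | ⟨i, hi⟩)
      · exact ⟨k, by rw [← hl]; simp⟩
      · refine ⟨i, ?_⟩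
        have := (List.getElem?_eq_some_iff.1 hi).1
        rw [List.getElem?_append_left this, hi]

lemma hist_length {α : Type*} (σ τ : Strategy α) (k : ℕ) : (hist σ τ k).length = k := by
  induction k with
  | zero => rfl
  | succ k ih => simp [hist, ih]

lemma hist_succ_move {α : Type*} (σ τ : Strategy α) (k : ℕ) :
    hist σ τ (k + 1) = hist σ τ k ++ [move σ τ k] := rfl

lemma hist_get {α : Type*} (σ τ : Strategy α) (k j : ℕ) (h : j < k) :
    (hist σ τ k)[j]? = some (move σ τ j) := by
  induction k with
  | zero => omega
  | succ k ih =>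
    rw [hist_succ_move]
    rcases Nat.lt_succ_iff_lt_or_eq.1 h with h | h
    · rw [List.getElem?_append_left (by rw [hist_length]; exact h), ih h]
    · subst h
      rw [List.getElem?_append_right (by rw [hist_length])]
      simp [hist_length]

/-- All moves in the list are edges, no repetitions. -/
def Legal (l : List (Sym2 (Fin n ⊕ Fin n))) : Prop :=
  l.Nodup ∧ ∀ x ∈ l, ∃ e, x = edgeOf e

lemma Legal.append {l : List (Sym2 (Fin n ⊕ Fin n))} (h : Legal l) {e : Fin n × Fin n}
    (he : edgeOf e ∉ l) : Legal (l ++ [edgeOf e]) := by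
  refine ⟨?_, ?_⟩
  · rw [List.nodup_append]
    refine ⟨h.1, by simp, ?_⟩
    intro a ha b hb
    simp at hb
    subst hb
    rintro rfl
    exact he ha
  · intro x hx
    simp at hx
    rcases hx with hx | hx
    · exact h.2 x hx
    · exact ⟨e, hx⟩

lemma Legal.length_le {l : List (Sym2 (Fin n ⊕ Fin n))} (h : Legal l) :
    l.length ≤ (completeBipartiteGraph (Fin n) (Fin n)).edgeSet.ncard := by
  classical
  rw [← List.toFinset_card_of_nodup h.1, ← Set.ncard_coe_finset]
  apply Set.ncard_le_ncard _ (Set.toFinite _)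
  intro x hx
  rw [mem_edgeSet_iff]
  exact h.2 x (by simpa using hx)

lemma blue_set (σ τ : Strategy (Fin n ⊕ Fin n)) (k : ℕ) (h : Legal (hist σ τ (2 * k + 1))) :
    {e | ∃ i ≤ k, e = move σ τ (2 * i)} =
      edgeOf '' (blueOf (hist σ τ (2 * k + 1)) : Set (Fin n × Fin n)) := by
  ext x
  simp only [Set.mem_ofPred_eq, Set.mem_image, blueOf, Finset.coe_filter, Finset.mem_univ, true_and]
  constructor
  · rintro ⟨i, hi, rfl⟩
    have hg := hist_get σ τ (2 * k + 1) (2 * i) (by omega)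
    obtain ⟨e, he⟩ := h.2 _ (List.mem_of_getElem? hg)
    exact ⟨e, ⟨i, by rw [hg, he]⟩, he.symm⟩
  · rintro ⟨e, ⟨i, hi⟩, rfl⟩
    have := (List.getElem?_eq_some_iff.1 hi).1
    rw [hist_length] at this
    rw [hist_get _ _ _ _ this] at hi
    exact ⟨i, by omega, (Option.some.inj hi).symm⟩

lemma red_set (σ τ : Strategy (Fin n ⊕ Fin n)) (k : ℕ) (h : Legal (hist σ τ (2 * k))) :
    {e | ∃ i < k, e = move σ τ (2 * i + 1)} =
      edgeOf '' (redOf (hist σ τ (2 * k)) : Set (Fin n × Fin n)) := by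
  ext x
  simp only [Set.mem_ofPred_eq, Set.mem_image, redOf, Finset.coe_filter, Finset.mem_univ, true_and]
  constructor
  · rintro ⟨i, hi, rfl⟩
    have hg := hist_get σ τ (2 * k) (2 * i + 1) (by omega)
    obtain ⟨e, he⟩ := h.2 _ (List.mem_of_getElem? hg)
    exact ⟨e, ⟨i, by rw [hg, he]⟩, he.symm⟩
  · rintro ⟨e, ⟨i, hi⟩, rfl⟩
    have := (List.getElem?_eq_some_iff.1 hi).1
    rw [hist_length] at this
    rw [hist_get _ _ _ _ this] at hi
    exact ⟨i, by omega, (Option.some.inj hi).symm⟩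

lemma move_even {α : Type*} (σ τ : Strategy α) (k : ℕ) :
    move σ τ (2 * k) = σ (hist σ τ (2 * k)) := by
  simp [move]

lemma move_odd {α : Type*} (σ τ : Strategy α) (k : ℕ) :
    move σ τ (2 * k + 1) = τ (hist σ τ (2 * k + 1)) := by
  have : (2 * k + 1) % 2 ≠ 0 := by omega
  simp only [move, this, if_false]

/-- A rule choosing a free cell gives a valid strategy. -/
noncomputable def stratOf (pick : Finset (Fin n × Fin n) → Finset (Fin n × Fin n) → Fin n × Fin n) :
    Strategy (Fin n ⊕ Fin n) := fun l => edgeOf (pick (blueOf l) (redOf l))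

lemma stratOf_valid (pick : Finset (Fin n × Fin n) → Finset (Fin n × Fin n) → Fin n × Fin n)
    (h : ∀ B R, (∃ e, e ∉ B ∧ e ∉ R) → pick B R ∉ B ∧ pick B R ∉ R) :
    (stratOf pick).Valid (completeBipartiteGraph (Fin n) (Fin n)) := by
  rintro l ⟨x, hx, hxl⟩
  obtain ⟨e, rfl⟩ := (mem_edgeSet_iff x).1 hx
  rw [mem_list_iff, not_or] at hxl
  have := h _ _ ⟨e, hxl⟩
  refine ⟨(mem_edgeSet_iff _).2 ⟨_, rfl⟩, ?_⟩
  unfold stratOf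
  rw [mem_list_iff, not_or]
  exact this

lemma valid_pick {s : Strategy (Fin n ⊕ Fin n)}
    (hs : s.Valid (completeBipartiteGraph (Fin n) (Fin n)))
    (l : List (Sym2 (Fin n ⊕ Fin n))) (h : ∃ e, e ∉ blueOf l ∧ e ∉ redOf l) :
    ∃ e, s l = edgeOf e ∧ e ∉ blueOf l ∧ e ∉ redOf l := by
  obtain ⟨e, he⟩ := h
  rw [← not_or, ← mem_list_iff] at he
  obtain ⟨h1, h2⟩ := hs l ⟨_, (mem_edgeSet_iff _).2 ⟨e, rfl⟩, he⟩
  obtain ⟨e', h'⟩ := (mem_edgeSet_iff _).1 h1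
  refine ⟨e', h', ?_⟩
  rw [← not_or, ← mem_list_iff, ← h']
  exact h2

/-- Alice, to move, can win within `t` of her moves. -/
def W {E : Type*} [DecidableEq E] (P : Finset E → Prop) : ℕ → Finset E → Finset E → Prop
  | 0, _, _ => False
  | t + 1, B, R => ∃ e, e ∉ B ∧ e ∉ R ∧ (P (insert e B) ∨
      ((∃ e', e' ∉ insert e B ∧ e' ∉ R) ∧ ∀ e', e' ∉ insert e B → e' ∉ R →
        ¬ P (insert e' R) ∧ W P t (insert e B) (insert e' R)))

lemma W_mono {E : Type*} [DecidableEq E] (P : Finset E → Prop) (t : ℕ) :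
    ∀ B R, W P t B R → W P (t + 1) B R := by
  induction t with
  | zero => intro B R h; exact h.elim
  | succ t ih =>
    rintro B R ⟨e, h1, h2, h3⟩
    refine ⟨e, h1, h2, h3.imp id fun h => ⟨h.1, fun e' a b => ⟨(h.2 e' a b).1, ih _ _ (h.2 e' a b).2⟩⟩⟩

lemma W_mono' {E : Type*} [DecidableEq E] (P : Finset E → Prop) {s t : ℕ} (hst : s ≤ t)
    {B R} (h : W P s B R) : W P t B R := by
  induction t, hst using Nat.le_induction with
  | base => exact h
  | succ t _ ih => exact W_mono P t _ _ ih

lemma exists_pick {E : Type*} [DecidableEq E] [Inhabited E] (P : Finset E → Prop) (B R : Finset E) :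
    ∃ e, ((∃ e', e' ∉ B ∧ e' ∉ R) → e ∉ B ∧ e ∉ R) ∧ ∀ t, W P (t + 1) B R →
      (P (insert e B) ∨
      ((∃ e', e' ∉ insert e B ∧ e' ∉ R) ∧ ∀ e', e' ∉ insert e B → e' ∉ R →
        ¬ P (insert e' R) ∧ W P t (insert e B) (insert e' R))) := by
  classical
  by_cases h : ∃ t, W P (t + 1) B R
  · obtain ⟨e, h1, h2, h3⟩ := Nat.find_spec h
    refine ⟨e, fun _ => ⟨h1, h2⟩, fun t ht => ?_⟩
    have hle := Nat.find_min' h ht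
    exact h3.imp id fun h => ⟨h.1, fun e' a b => ⟨(h.2 e' a b).1, W_mono' P hle (h.2 e' a b).2⟩⟩
  · push Not at h
    by_cases h' : ∃ e', e' ∉ B ∧ e' ∉ R
    · obtain ⟨e, he⟩ := h'
      exact ⟨e, fun _ => he, fun t ht => (h t ht).elim⟩
    · exact ⟨default, fun h => (h' h).elim, fun t ht => (h t ht).elim⟩

theorem aliceWins_of_W (m t : ℕ) (hm : 1 ≤ m) (hW : W (HasM (n := n) m) t ∅ ∅) :
    AliceWins (matching m) (completeBipartiteGraph (Fin n) (Fin n)) := by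
  classical
  have hne : Nonempty (Fin n × Fin n) := by
    cases t with
    | zero => exact hW.elim
    | succ t => exact ⟨hW.choose⟩
  have : Inhabited (Fin n × Fin n) := ⟨hne.some⟩
  choose pick hp1 hp2 using exists_pick (E := Fin n × Fin n) (HasM m)
  refine ⟨stratOf pick, stratOf_valid pick hp1, fun τ hτ => ?_⟩
  set σ := stratOf pick with hσ
  have main : ∀ t k, Legal (hist σ τ (2 * k)) →
      ¬ HasM m (redOf (hist σ τ (2 * k))) →
      W (HasM m) t (blueOf (hist σ τ (2 * k))) (redOf (hist σ τ (2 * k))) →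
      ∃ k, 2 * k + 1 ≤ (completeBipartiteGraph (Fin n) (Fin n)).edgeSet.ncard ∧
      HasCopy (matching m) {e | ∃ i ≤ k, e = move σ τ (2 * i)} ∧
      ¬ HasCopy (matching m) {e | ∃ i < k, e = move σ τ (2 * i + 1)} := by
    intro t
    induction t with
    | zero => intro k _ _ h; exact h.elim
    | succ t ih =>
      intro k hleg hred hw
      obtain ⟨e0, h1, h2, -⟩ := id hw
      have hfree := hp1 _ _ ⟨e0, h1, h2⟩
      have hgood := hp2 _ _ t hw
      set e := pick (blueOf (hist σ τ (2 * k))) (redOf (hist σ τ (2 * k))) with he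
      have hmv : move σ τ (2 * k) = edgeOf e := by rw [move_even]; rfl
      have hh : hist σ τ (2 * k + 1) = hist σ τ (2 * k) ++ [edgeOf e] := by
        rw [hist_succ_move, hmv]
      have hleg' : Legal (hist σ τ (2 * k + 1)) := by
        rw [hh]
        apply hleg.append
        rw [mem_list_iff, not_or]
        exact hfree
      obtain ⟨hb, hr⟩ := blueOf_append_even (hist σ τ (2 * k)) e (hist_length σ τ (2 * k))
      rw [← hh] at hb hr
      rcases hgood with hg | ⟨hex, hall⟩
      · refine ⟨k, ?_, ?_, ?_⟩
        · have := hleg'.length_le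
          rwa [hist_length] at this
        · rw [blue_set σ τ k hleg', hasCopy_iff, hb]
          exact hg
        · rw [red_set σ τ k hleg, hasCopy_iff]
          exact hred
      · rw [← hb, ← hr] at hex hall
        obtain ⟨e', he', hf1, hf2⟩ := valid_pick hτ (hist σ τ (2 * k + 1)) hex
        obtain ⟨hn, hw'⟩ := hall e' hf1 hf2
        have hh2 : hist σ τ (2 * (k + 1)) = hist σ τ (2 * k + 1) ++ [edgeOf e'] := by
          rw [← (move_odd σ τ k).trans he']; rfl
        obtain ⟨hb2, hr2⟩ := redOf_append_odd (hist σ τ (2 * k + 1)) e' (hist_length σ τ (2 * k + 1))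
        rw [← hh2] at hb2 hr2
        apply ih (k + 1)
        · rw [hh2]
          apply hleg'.append
          rw [mem_list_iff, not_or]
          exact ⟨hf1, hf2⟩
        · rw [hr2]; exact hn
        · rw [hb2, hr2]; exact hw'
  have hB : blueOf (n := n) [] = ∅ := by ext; simp [blueOf]
  have hR : redOf (n := n) [] = ∅ := by ext; simp [redOf]
  apply main t 0
  · exact ⟨by simp [hist], by simp [hist]⟩
  · show ¬ HasM m (redOf [])
    rw [hR]
    rintro ⟨f, g, -, -, h⟩
    simpa using h ⟨0, hm⟩
  · show W _ t (blueOf []) (redOf [])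
    rw [hB, hR]; exact hW

theorem not_aliceWins (m : ℕ) [Inhabited (Fin n × Fin n)]
    (S : Finset (Fin n × Fin n) → Finset (Fin n × Fin n) → Prop) (h0 : S ∅ ∅)
    (hS : ∀ B R e, S B R → e ∉ B → e ∉ R → ¬ HasM m (insert e B) ∧
      ((∃ e', e' ∉ insert e B ∧ e' ∉ R) →
        ∃ e', e' ∉ insert e B ∧ e' ∉ R ∧ S (insert e B) (insert e' R))) :
    ¬ AliceWins (matching m) (completeBipartiteGraph (Fin n) (Fin n)) := by
  classical
  rintro ⟨σ, hσ, hwin⟩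
  have hpick : ∀ B R : Finset (Fin n × Fin n), ∃ e,
      ((∃ e', e' ∉ B ∧ e' ∉ R) → e ∉ B ∧ e ∉ R) ∧
      ((∃ e', e' ∉ B ∧ e' ∉ R ∧ S B (insert e' R)) → S B (insert e R)) := by
    intro B R
    by_cases h : ∃ e', e' ∉ B ∧ e' ∉ R ∧ S B (insert e' R)
    · obtain ⟨e, h1, h2, h3⟩ := h
      exact ⟨e, fun _ => ⟨h1, h2⟩, fun _ => h3⟩
    · by_cases h' : ∃ e', e' ∉ B ∧ e' ∉ R
      · exact ⟨h'.choose, fun _ => h'.choose_spec, fun hh => (h hh).elim⟩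
      · exact ⟨default, fun hh => (h' hh).elim, fun hh => (h hh).elim⟩
  choose pick hp1 hp2 using hpick
  obtain ⟨k, hk, hcopy, -⟩ := hwin (stratOf pick) (stratOf_valid pick hp1)
  set τ := stratOf pick with hτ
  have hfree : ∀ l : List (Sym2 (Fin n ⊕ Fin n)),
      l.length < (completeBipartiteGraph (Fin n) (Fin n)).edgeSet.ncard →
      ∃ e, e ∉ blueOf l ∧ e ∉ redOf l := by
    intro l hl
    by_contra hcon
    push Not at hcon
    have : (completeBipartiteGraph (Fin n) (Fin n)).edgeSet ⊆ (l.toFinset : Set _) := by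
      intro x hx
      obtain ⟨e, rfl⟩ := (mem_edgeSet_iff x).1 hx
      have : edgeOf e ∈ l := by
        rw [mem_list_iff]
        by_cases hb : e ∈ blueOf l
        · exact Or.inl hb
        · exact Or.inr (hcon e hb)
      simpa using this
    have h1 := Set.ncard_le_ncard this (Finset.finite_toSet _)
    rw [Set.ncard_coe_finset] at h1
    have h2 := List.toFinset_card_le l
    omega
  have alice : ∀ j, j ≤ k → Legal (hist σ τ (2 * j)) →
      ∃ e, hist σ τ (2 * j + 1) = hist σ τ (2 * j) ++ [edgeOf e] ∧
        e ∉ blueOf (hist σ τ (2 * j)) ∧ e ∉ redOf (hist σ τ (2 * j)) ∧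
        Legal (hist σ τ (2 * j + 1)) ∧
        blueOf (hist σ τ (2 * j + 1)) = insert e (blueOf (hist σ τ (2 * j))) ∧
        redOf (hist σ τ (2 * j + 1)) = redOf (hist σ τ (2 * j)) := by
    intro j hj hleg
    obtain ⟨e, he, hf1, hf2⟩ := valid_pick hσ (hist σ τ (2 * j))
      (hfree _ (by rw [hist_length]; omega))
    have hh : hist σ τ (2 * j + 1) = hist σ τ (2 * j) ++ [edgeOf e] := by
      rw [← (move_even σ τ j).trans he]; rfl
    obtain ⟨hb, hr⟩ := blueOf_append_even (hist σ τ (2 * j)) e (hist_length σ τ (2 * j))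
    rw [← hh] at hb hr
    refine ⟨e, hh, hf1, hf2, ?_, hb, hr⟩
    rw [hh]
    apply hleg.append
    rw [mem_list_iff, not_or]
    exact ⟨hf1, hf2⟩
  have main : ∀ j, j ≤ k → Legal (hist σ τ (2 * j)) ∧
      S (blueOf (hist σ τ (2 * j))) (redOf (hist σ τ (2 * j))) := by
    intro j
    induction j with
    | zero =>
      intro _
      have hB : blueOf (n := n) [] = ∅ := by ext; simp [blueOf]
      have hR : redOf (n := n) [] = ∅ := by ext; simp [redOf]
      refine ⟨⟨by simp [hist], by simp [hist]⟩, ?_⟩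
      show S (blueOf []) (redOf [])
      rw [hB, hR]; exact h0
    | succ j ih =>
      intro hj
      obtain ⟨hleg, hs⟩ := ih (by omega)
      obtain ⟨e, -, hf1, hf2, hleg', hb, hr⟩ := alice j (by omega) hleg
      have hfr := hfree (hist σ τ (2 * j + 1)) (by rw [hist_length]; omega)
      have hex := (hS _ _ e hs hf1 hf2).2
      rw [← hb, ← hr] at hex
      have h3 := hp2 _ _ (hex hfr)
      have h4 := hp1 _ _ hfr
      set e' := pick (blueOf (hist σ τ (2 * j + 1))) (redOf (hist σ τ (2 * j + 1))) with he'
      have hh2 : hist σ τ (2 * (j + 1)) = hist σ τ (2 * j + 1) ++ [edgeOf e'] := by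
        have : τ (hist σ τ (2 * j + 1)) = edgeOf e' := rfl
        rw [← (move_odd σ τ j).trans this]; rfl
      obtain ⟨hb2, hr2⟩ := redOf_append_odd (hist σ τ (2 * j + 1)) e' (hist_length σ τ (2 * j + 1))
      rw [← hh2] at hb2 hr2
      refine ⟨?_, ?_⟩
      · rw [hh2]
        apply hleg'.append
        rw [mem_list_iff, not_or]
        exact h4
      · rw [hb2, hr2]; exact h3
  obtain ⟨hleg, hs⟩ := main k le_rfl
  obtain ⟨e, -, hf1, hf2, hleg', hb, hr⟩ := alice k le_rfl hleg
  rw [blue_set σ τ k hleg', hasCopy_iff, hb] at hcopy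
  exact (hS _ _ e hs hf1 hf2).1 hcopy

lemma not_aliceWins_of_lt {m : ℕ} (h : n < m) :
    ¬ AliceWins (matching m) (completeBipartiteGraph (Fin n) (Fin n)) := by
  classical
  rintro ⟨σ, hσ, hwin⟩
  obtain ⟨k, -, ⟨f, -⟩, -⟩ := hwin σ hσ
  have := Fintype.card_le_of_embedding f
  simp at this
  omega

end General


section Small

lemma HasM.card_le {n m : ℕ} {S : Finset (Fin n × Fin n)} (h : HasM m S) : m ≤ S.card := by
  obtain ⟨f, g, hf, hg, h⟩ := h
  have := Finset.card_le_card_of_injOn (s := (Finset.univ : Finset (Fin m))) (t := S)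
    (fun i => (f i, g i)) (fun i _ => h i) (fun i _ j _ hij => hf (Prod.mk.inj hij).1)
  simpa using this

lemma greedy_cell {n k : ℕ} (f g : Fin k → Fin n) (R : Finset (Fin n × Fin n))
    (hf : Function.Injective f) (hg : Function.Injective g) (hR : R.card ≤ k)
    (h : k < (n - k) * (n - k)) :
    ∃ x y, (x, y) ∉ R ∧ (∀ i, f i ≠ x) ∧ (∀ i, g i ≠ y) := by
  classical
  have hc : ∀ f : Fin k → Fin n, Function.Injective f →
      (Finset.univ \ Finset.univ.image f).card = n - k := by
    intro f hf
    rw [Finset.card_sdiff_of_subset (Finset.subset_univ _), Finset.card_image_of_injective _ hf]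
    simp
  obtain ⟨⟨x, y⟩, he, heR⟩ := Finset.exists_mem_notMem_of_card_lt_card (s := R)
    (t := (Finset.univ \ Finset.univ.image f) ×ˢ (Finset.univ \ Finset.univ.image g))
    (by rw [Finset.card_product, hc f hf, hc g hg]; omega)
  simp at he
  exact ⟨x, y, heR, he.1, he.2⟩

lemma greedy_insert {n k : ℕ} (f g : Fin k → Fin n) (x y : Fin n) :
    insert (x, y) (Finset.univ.image fun i => (f i, g i)) =
      Finset.univ.image fun i : Fin (k + 1) =>
        ((Fin.cons x f : Fin (k + 1) → Fin n) i, (Fin.cons y g : Fin (k + 1) → Fin n) i) := by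
  ext e
  simp only [Finset.mem_insert, Finset.mem_image, Finset.mem_univ, true_and, Fin.exists_fin_succ,
    Fin.cons_zero, Fin.cons_succ]
  rw [eq_comm]

lemma greedy {n m : ℕ} (h1 : ∀ k < m, k < (n - k) * (n - k)) (h2 : ∀ k, k + 1 < m → 2 * k + 1 < n * n)
    (d : ℕ) : ∀ (k : ℕ) (f g : Fin k → Fin n) (R : Finset (Fin n × Fin n)), k + d + 1 = m →
      Function.Injective f → Function.Injective g → R.card ≤ k →
      W (HasM (n := n) m) (d + 1) (Finset.univ.image fun i => (f i, g i)) R := by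
  induction d with
  | zero =>
    intro k f g R hk hf hg hR
    obtain ⟨x, y, hxy, hx, hy⟩ := greedy_cell f g R hf hg hR (h1 k (by omega))
    refine ⟨(x, y), ?_, hxy, Or.inl ?_⟩
    · simp only [Finset.mem_image, Finset.mem_univ, true_and, not_exists, Prod.mk.injEq]
      exact fun i h => hx i h.1
    · rw [greedy_insert]
      obtain rfl : k + 1 = m := by omega
      refine ⟨Fin.cons x f, Fin.cons y g, Fin.cons_injective_iff.2 ⟨by simpa using hx, hf⟩,
        Fin.cons_injective_iff.2 ⟨by simpa using hy, hg⟩, fun i => ?_⟩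
      exact Finset.mem_image.2 ⟨i, Finset.mem_univ _, rfl⟩
  | succ d ih =>
    intro k f g R hk hf hg hR
    obtain ⟨x, y, hxy, hx, hy⟩ := greedy_cell f g R hf hg hR (h1 k (by omega))
    refine ⟨(x, y), ?_, hxy, Or.inr ⟨?_, ?_⟩⟩
    · simp only [Finset.mem_image, Finset.mem_univ, true_and, not_exists, Prod.mk.injEq]
      exact fun i h => hx i h.1
    · have hcard : (insert (x, y) (Finset.univ.image fun i => (f i, g i)) ∪ R).card
          < (Finset.univ : Finset (Fin n × Fin n)).card := by
        have a1 := Finset.card_union_le (insert (x, y) (Finset.univ.image fun i => (f i, g i))) R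
        have a2 := Finset.card_insert_le (x, y) (Finset.univ.image fun i => (f i, g i))
        have a3 := Finset.card_image_le (s := Finset.univ) (f := fun i => (f i, g i))
        have a4 := h2 k (by omega)
        simp only [Finset.card_univ, Fintype.card_prod, Fintype.card_fin] at a3 ⊢
        omega
      obtain ⟨e, -, he⟩ := Finset.exists_mem_notMem_of_card_lt_card hcard
      rw [Finset.mem_union, not_or] at he
      exact ⟨e, he⟩
    · intro e' _ _
      have hc := Finset.card_insert_le e' R
      refine ⟨fun hM => ?_, ?_⟩
      · have := hM.card_le
        omega
      · rw [greedy_insert]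
        exact ih (k + 1) _ _ _ (by omega) (Fin.cons_injective_iff.2 ⟨by simpa using hx, hf⟩)
          (Fin.cons_injective_iff.2 ⟨by simpa using hy, hg⟩) (by omega)

lemma greedy_wins {n m : ℕ} (hm : 1 ≤ m) (h1 : ∀ k < m, k < (n - k) * (n - k))
    (h2 : ∀ k, k + 1 < m → 2 * k + 1 < n * n) :
    AliceWins (matching m) (completeBipartiteGraph (Fin n) (Fin n)) := by
  apply aliceWins_of_W m (m - 1 + 1) hm
  have := greedy h1 h2 (m - 1) 0 Fin.elim0 Fin.elim0 ∅ (by omega)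
    (fun i => i.elim0) (fun i => i.elim0) (by simp)
  simpa using this

/-- Search on bitmasks whether the second player can block. -/
def safe (cells : ℕ) (pm : ℕ → Bool) : ℕ → ℕ → ℕ → Bool
  | 0, _, _ => false
  | t + 1, b, r => (List.range cells).all fun e => (b ||| r).testBit e ||
      (!pm (b ||| 1 <<< e) && ((b ||| 1 <<< e ||| r) == 2 ^ cells - 1 ||
        (List.range cells).any fun f => !(b ||| 1 <<< e ||| r).testBit f &&
          safe cells pm t (b ||| 1 <<< e) (r ||| 1 <<< f)))

/-- Perfect matchings of `K_{3,3}` on bitmasks. -/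
def pm3 (b : ℕ) : Bool :=
  (b.testBit 0 && ((b.testBit 4 && b.testBit 8) || (b.testBit 5 && b.testBit 7))) ||
  (b.testBit 1 && ((b.testBit 3 && b.testBit 8) || (b.testBit 5 && b.testBit 6))) ||
  (b.testBit 2 && ((b.testBit 3 && b.testBit 7) || (b.testBit 4 && b.testBit 6)))

/-- Perfect matchings of `K_{2,2}` on bitmasks. -/
def pm2 (b : ℕ) : Bool :=
  (b.testBit 0 && b.testBit 3) || (b.testBit 1 && b.testBit 2)

lemma safe3 : safe 9 pm3 5 0 0 = true := by decide +kernel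
lemma safe2 : safe 4 pm2 3 0 0 = true := by decide +kernel

/-- The bitmask `b` represents the set `B`. -/
def MaskOf {n : ℕ} (B : Finset (Fin n × Fin n)) (b : ℕ) : Prop :=
  ∀ e : Fin n × Fin n, e ∈ B ↔ b.testBit (finProdFinEquiv e : ℕ) = true

lemma MaskOf.insert {n : ℕ} {B : Finset (Fin n × Fin n)} {b : ℕ} (h : MaskOf B b) (e : Fin n × Fin n) :
    MaskOf (insert e B) (b ||| 1 <<< (finProdFinEquiv e : ℕ)) := by
  intro x
  rw [Finset.mem_insert, h x, Nat.testBit_or, Nat.one_shiftLeft, Nat.testBit_two_pow]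
  simp only [Bool.or_eq_true, decide_eq_true_eq, Fin.val_inj, finProdFinEquiv.injective.eq_iff]
  tauto

lemma not_aliceWins_of_safe {n : ℕ} [Inhabited (Fin n × Fin n)] (pm : ℕ → Bool)
    (hpm : ∀ (B : Finset (Fin n × Fin n)) b, MaskOf B b → HasM n B → pm b = true) (t : ℕ)
    (hs : safe (n * n) pm t 0 0 = true) :
    ¬ AliceWins (matching n) (completeBipartiteGraph (Fin n) (Fin n)) := by
  apply not_aliceWins n (fun B R => ∃ t b r, MaskOf B b ∧ MaskOf R r ∧ safe (n * n) pm t b r = true)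
  · exact ⟨t, 0, 0, by simp [MaskOf], by simp [MaskOf], hs⟩
  · rintro B R e ⟨t, b, r, hb, hr, h⟩ he1 he2
    cases t with
    | zero => simp [safe] at h
    | succ t =>
      rw [safe, List.all_eq_true] at h
      have h' := h (finProdFinEquiv e : ℕ) (by rw [List.mem_range]; exact Fin.is_lt _)
      rw [hb e] at he1
      rw [hr e] at he2
      have hb' := hb.insert e
      generalize b ||| 1 <<< (finProdFinEquiv e : ℕ) = b' at h' hb'
      simp only [Nat.testBit_or, he1, he2, Bool.or_eq_true, Bool.false_or, Bool.and_eq_true,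
        Bool.not_eq_true', false_or, or_self] at h'
      obtain ⟨h1, h2⟩ := h'
      refine ⟨fun hM => ?_, ?_⟩
      · rw [hpm _ _ hb' hM] at h1
        simp at h1
      · rintro ⟨e', h3, h4⟩
        rcases h2 with h2 | h2
        · exfalso
          rw [hb' e'] at h3
          rw [hr e'] at h4
          have h5 : (b' ||| r).testBit (finProdFinEquiv e' : ℕ) = true := by
            rw [beq_iff_eq.1 h2, Nat.testBit_two_pow_sub_one]
            exact decide_eq_true (Fin.is_lt _)
          rw [Nat.testBit_or] at h5
          simp_all
        · rw [List.any_eq_true] at h2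
          obtain ⟨f, hf, hf2⟩ := h2
          rw [List.mem_range] at hf
          obtain ⟨x, hx⟩ := finProdFinEquiv.surjective (⟨f, hf⟩ : Fin (n * n))
          have hx' : f = (finProdFinEquiv x : ℕ) := by rw [hx]
          subst hx'
          simp only [Nat.testBit_or, Bool.and_eq_true, Bool.not_eq_true', Bool.or_eq_false_iff] at hf2
          refine ⟨x, ?_, ?_, t, _, _, hb', hr.insert x, hf2.2⟩
          · rw [hb' x, hf2.1.1]; exact Bool.false_ne_true
          · rw [hr x, hf2.1.2]; exact Bool.false_ne_true

lemma not_win3 : ¬ AliceWins (matching 3) (completeBipartiteGraph (Fin 3) (Fin 3)) := by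
  apply not_aliceWins_of_safe pm3 _ 5 safe3
  rintro B b hB ⟨f, g, hf, hg, h⟩
  have h0 := (hB _).1 (h 0)
  have h1 := (hB _).1 (h 1)
  have h2 := (hB _).1 (h 2)
  have f01 := hf.ne (show (0 : Fin 3) ≠ 1 by decide)
  have f02 := hf.ne (show (0 : Fin 3) ≠ 2 by decide)
  have f12 := hf.ne (show (1 : Fin 3) ≠ 2 by decide)
  have g01 := hg.ne (show (0 : Fin 3) ≠ 1 by decide)
  have g02 := hg.ne (show (0 : Fin 3) ≠ 2 by decide)
  have g12 := hg.ne (show (1 : Fin 3) ≠ 2 by decide)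
  simp only [finProdFinEquiv_apply_val] at h0 h1 h2
  generalize f 0 = a0 at *
  generalize f 1 = a1 at *
  generalize f 2 = a2 at *
  generalize g 0 = c0 at *
  generalize g 1 = c1 at *
  generalize g 2 = c2 at *
  clear h hf hg hB
  fin_cases a0 <;> fin_cases a1 <;> first | (exfalso; simp at f01; done) | skip
  all_goals fin_cases a2 <;> first | (exfalso; simp at f02; done) | (exfalso; simp at f12; done) | skip
  all_goals fin_cases c0 <;> fin_cases c1 <;> first | (exfalso; simp at g01; done) | skip
  all_goals fin_cases c2 <;> first | (exfalso; simp at g02; done) | (exfalso; simp at g12; done) | skip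
  all_goals simp at h0 h1 h2; simp [pm3, h0, h1, h2]

lemma not_win2 : ¬ AliceWins (matching 2) (completeBipartiteGraph (Fin 2) (Fin 2)) := by
  apply not_aliceWins_of_safe pm2 _ 3 safe2
  rintro B b hB ⟨f, g, hf, hg, h⟩
  have h0 := (hB _).1 (h 0)
  have h1 := (hB _).1 (h 1)
  have f01 := hf.ne (show (0 : Fin 2) ≠ 1 by decide)
  have g01 := hg.ne (show (0 : Fin 2) ≠ 1 by decide)
  simp only [finProdFinEquiv_apply_val] at h0 h1
  generalize f 0 = a0 at *
  generalize f 1 = a1 at *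
  generalize g 0 = c0 at *
  generalize g 1 = c1 at *
  clear h hf hg hB
  fin_cases a0 <;> fin_cases a1 <;> first | (exfalso; simp at f01; done) | skip
  all_goals fin_cases c0 <;> fin_cases c1 <;> first | (exfalso; simp at g01; done) | skip
  all_goals simp at h0 h1; simp [pm2, h0, h1]

end Small


section Main
variable {m : ℕ}

/-- Perfect matching inside a set of cells. -/
def HasPM (S : Finset (Fin m × Fin m)) : Prop := ∃ π : Equiv.Perm (Fin m), ∀ i, (i, π i) ∈ S

lemma hasM_eq : HasM (n := m) m = HasPM := by
  funext S
  apply propext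
  constructor
  · rintro ⟨f, g, hf, hg, h⟩
    have hf' := Finite.injective_iff_bijective.1 hf
    have hg' := Finite.injective_iff_bijective.1 hg
    refine ⟨(Equiv.ofBijective f hf').symm.trans (Equiv.ofBijective g hg'), fun i => ?_⟩
    have := h ((Equiv.ofBijective f hf').symm i)
    rw [Equiv.ofBijective_apply_symm_apply f hf' i] at this
    exact this
  · rintro ⟨π, h⟩
    exact ⟨id, π, Function.injective_id, π.injective, h⟩

lemma HasPM.mono {S T : Finset (Fin m × Fin m)} (h : HasPM S) (hST : S ⊆ T) : HasPM T := by
  obtain ⟨π, h⟩ := h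
  exact ⟨π, fun i => hST (h i)⟩

lemma graph_card (π : Equiv.Perm (Fin m)) :
    (Finset.univ.image fun i => (i, π i)).card = m := by
  rw [Finset.card_image_of_injective _ (fun a b h => (Prod.mk.inj h).1)]
  simp

lemma HasPM.card_le' {S : Finset (Fin m × Fin m)} (h : HasPM S) : m ≤ S.card := by
  obtain ⟨π, h⟩ := h
  refine (graph_card π).symm.le.trans ?_
  apply Finset.card_le_card
  intro e he
  simp only [Finset.mem_image, Finset.mem_univ, true_and] at he
  obtain ⟨i, rfl⟩ := he
  exact h i

lemma W_equiv {E : Type*} [DecidableEq E] (P : Finset E → Prop) (φ : E ≃ E)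
    (hP : ∀ S, P (S.map φ.toEmbedding) ↔ P S) (t : ℕ) :
    ∀ B R, W P t (B.map φ.toEmbedding) (R.map φ.toEmbedding) → W P t B R := by
  induction t with
  | zero => intro B R h; exact h
  | succ t ih =>
    rintro B R ⟨e, h1, h2, h3⟩
    obtain ⟨e, rfl⟩ := φ.surjective e
    have key : ∀ (x : E) (S : Finset E),
        insert (φ x) (S.map φ.toEmbedding) = (insert x S).map φ.toEmbedding := by
      intro x S; simp [Finset.map_insert]
    have key2 : ∀ (x : E) (S : Finset E), φ x ∈ S.map φ.toEmbedding ↔ x ∈ S := by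
      intro x S; simp
    rw [key2] at h1 h2
    refine ⟨e, h1, h2, ?_⟩
    rw [key, hP] at h3
    refine h3.imp id ?_
    rintro ⟨⟨e', h4, h5⟩, h6⟩
    constructor
    · obtain ⟨e', rfl⟩ := φ.surjective e'
      rw [key2] at h4 h5
      exact ⟨e', h4, h5⟩
    · intro e' h7 h8
      have := h6 (φ e') (by rwa [key2]) (by rwa [key2])
      rw [key, hP] at this
      exact ⟨this.1, ih _ _ this.2⟩

/-- No cell of `R` inside `X × Y`, at most one cell touching. -/
def Clean (X Y : Finset (Fin m)) (R : Finset (Fin m × Fin m)) : Prop :=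
  (∀ e ∈ R, ¬ (e.1 ∈ X ∧ e.2 ∈ Y)) ∧
  ∀ e ∈ R, ∀ e' ∈ R, (e.1 ∈ X ∨ e.2 ∈ Y) → (e'.1 ∈ X ∨ e'.2 ∈ Y) → e = e'

/-- The condition needed for the endgame. -/
def Cond (x : Fin m) (X Y : Finset (Fin m)) (y : Fin m) (R : Finset (Fin m × Fin m)) : Prop :=
  (∃ e ∈ R, e.1 ∈ X.erase x ∨ e.2 ∈ Y.erase y) ∨ (∀ e ∈ R, e.1 ∉ X ∧ e.2 ∉ Y) ∨
    (∃ e ∈ R, ∃ e' ∈ R, e ≠ e' ∧ (e.1 = e'.1 ∨ e.2 = e'.2))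

lemma step (X Y : Finset (Fin m)) (R : Finset (Fin m × Fin m)) (e0 : Fin m × Fin m)
    (hX : 2 ≤ X.card) (hY : 2 ≤ Y.card) (hc : Clean X Y (R.erase e0)) :
    ∃ x ∈ X, ∃ y ∈ Y, (x, y) ∉ R ∧ Clean (X.erase x) (Y.erase y) R ∧ Cond x X Y y R := by
  have hX' : ∀ p, ∃ x ∈ X, x ≠ p := fun p => Finset.exists_mem_ne hX p
  have hY' : ∀ p, ∃ x ∈ Y, x ≠ p := fun p => Finset.exists_mem_ne hY p
  obtain ⟨p, q⟩ := e0
  obtain ⟨x0, hx0, hx0p⟩ := hX' p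
  obtain ⟨y0, hy0, hy0q⟩ := hY' q
  obtain ⟨hc1, hc2⟩ := hc
  simp only [Finset.mem_erase, Prod.forall, ne_eq, Prod.mk.injEq] at hc1 hc2
  simp only [Clean, Cond, Finset.mem_erase, Prod.forall, Prod.exists, ne_eq, Prod.mk.injEq]
  by_cases ht : ∃ t1 t2, (t1, t2) ∈ R ∧ ¬ (t1 = p ∧ t2 = q) ∧ (t1 ∈ X ∨ t2 ∈ Y)
  · obtain ⟨t1, t2, htR, hte, htt⟩ := ht
    have huniq : ∀ a b, (a, b) ∈ R → (a ∈ X ∨ b ∈ Y) → (a = p ∧ b = q) ∨ (a = t1 ∧ b = t2) := by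
      intro a b hab hab2
      by_cases h : a = p ∧ b = q
      · exact Or.inl h
      · exact Or.inr (hc2 a b ⟨h, hab⟩ t1 t2 ⟨hte, htR⟩ hab2 htt)
    have hnin := hc1 t1 t2 ⟨hte, htR⟩
    clear hc1 hc2
    by_cases he : (p, q) ∈ R ∧ (p ∈ X ∨ q ∈ Y)
    · obtain ⟨he, hpq⟩ := he
      by_cases hp : p ∈ X <;> by_cases hq : q ∈ Y
      · by_cases h1 : t1 ∈ X
        · by_cases h2 : t1 = p
          · refine ⟨p, hp, y0, hy0, ?_, ?_, ?_⟩ <;> grind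
          · refine ⟨t1, h1, q, hq, ?_, ?_, ?_⟩ <;> grind
        · by_cases h2 : t2 = q
          · refine ⟨x0, hx0, q, hq, ?_, ?_, ?_⟩ <;> grind
          · refine ⟨p, hp, t2, by tauto, ?_, ?_, ?_⟩ <;> grind
      · by_cases h1 : t1 ∈ X
        · refine ⟨t1, h1, y0, hy0, ?_, ?_, ?_⟩ <;> grind
        · refine ⟨x0, hx0, t2, by tauto, ?_, ?_, ?_⟩ <;> grind
      · by_cases h1 : t1 ∈ X
        · refine ⟨t1, h1, y0, hy0, ?_, ?_, ?_⟩ <;> grind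
        · refine ⟨x0, hx0, t2, by tauto, ?_, ?_, ?_⟩ <;> grind
      · tauto
    · obtain ⟨x1, hx1, hx1p⟩ := hX' t1
      obtain ⟨y1, hy1, hy1q⟩ := hY' t2
      refine ⟨x1, hx1, y1, hy1, ?_, ?_, ?_⟩ <;> grind
  · push Not at ht
    by_cases he : (p, q) ∈ R ∧ (p ∈ X ∨ q ∈ Y)
    · obtain ⟨he, hpq⟩ := he
      by_cases hp : p ∈ X <;> by_cases hq : q ∈ Y
      · refine ⟨p, hp, y0, hy0, ?_, ?_, ?_⟩ <;> grind
      · refine ⟨x0, hx0, y0, hy0, ?_, ?_, ?_⟩ <;> grind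
      · refine ⟨x0, hx0, y0, hy0, ?_, ?_, ?_⟩ <;> grind
      · tauto
    · refine ⟨x0, hx0, y0, hy0, ?_, ?_, ?_⟩ <;> grind


/-- If the red set with the two extra cells in column `a` contains a perfect matching, then
this matching uses the extra cell `g` and all of `E0`. -/
lemma pm_forced {E0 : Finset (Fin m × Fin m)} {a i : Fin m} {g : Fin m × Fin m}
    (hE : E0.card + 2 = m) (hi : i ≠ a) (π : Equiv.Perm (Fin m))
    (hπ : ∀ k, (k, π k) ∈ insert g (insert (i, a) (insert (a, a) E0))) :
    (∀ e ∈ E0, e.2 = π e.1) ∧ (π a = a ∨ π i = a) := by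
  set Q := Finset.univ.image fun k => (k, π k) with hQ
  have hQc : Q.card = m := graph_card π
  have hmem : ∀ e, e ∈ Q ↔ e.2 = π e.1 := by
    rintro ⟨x, y⟩
    simp [hQ, eq_comm]
  have main : ∀ c : Fin m × Fin m, (Q ⊆ insert c (insert g E0)) →
      (∀ e ∈ E0, e.2 = π e.1) ∧ c.2 = π c.1 := by
    intro c hc
    have h1 : (insert c (insert g E0)).card ≤ Q.card := by
      have := Finset.card_insert_le c (insert g E0)
      have := Finset.card_insert_le g E0
      omega
    have h2 := Finset.eq_of_subset_of_card_le hc h1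
    refine ⟨fun e he => ?_, ?_⟩
    · rw [← hmem, h2]; simp [he]
    · rw [← hmem, h2]; simp
  by_cases h : π a = a
  · have hia : π i ≠ a := fun h' => hi (π.injective (h'.trans h.symm))
    have := main (a, a) (by
      rintro ⟨x, y⟩ hxy
      have h3 := (hmem _).1 hxy
      simp only at h3
      subst h3
      have := hπ x
      simp only [Finset.mem_insert, Prod.mk.injEq] at this ⊢
      grind)
    exact ⟨this.1, Or.inl h⟩
  · have := main (i, a) (by
      rintro ⟨x, y⟩ hxy
      have h3 := (hmem _).1 hxy
      simp only at h3
      subst h3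
      have := hπ x
      simp only [Finset.mem_insert, Prod.mk.injEq] at this ⊢
      grind)
    exact ⟨this.1, Or.inr this.2.symm⟩

lemma endgame1 {B E0 : Finset (Fin m × Fin m)} {a i j : Fin m}
    (hB : ∀ e, e ∈ B ↔ e.1 ≠ a ∧ e.2 = e.1)
    (hia : i ≠ a) (hja : j ≠ a) (hij : i ≠ j)
    (h1 : (a, i) ∉ E0) (h2 : (i, a) ∉ E0) (h3 : (j, a) ∉ E0) (h4 : (a, j) ∉ E0)
    (h5 : (i, j) ∉ E0)
    (nb : ∀ g, g ∉ B → g ≠ (a, i) →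
      ¬ HasPM (insert g (insert (i, a) (insert (a, a) E0)))) :
    W HasPM 3 B (insert (a, a) E0) := by
  refine ⟨(a, i), by simp [hB], by simp [h1, hia], Or.inr ⟨⟨(i, a), ?_, ?_⟩, ?_⟩⟩
  · simp [hB, hia, Ne.symm hia]
  · simp [h2, hia]
  intro e' he1 he2
  simp only [Finset.mem_insert, not_or] at he1
  refine ⟨fun h => nb e' he1.2 he1.1 (h.mono ?_), ?_⟩
  · exact Finset.insert_subset_insert _ (Finset.subset_insert _ _)
  by_cases hc : e' = (i, a)
  · subst hc
    refine ⟨(j, a), ?_, ?_, Or.inr ⟨⟨(a, j), ?_, ?_⟩, ?_⟩⟩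
    · simp [hB, hja, Ne.symm hja]
    · simp [h3, hja, Ne.symm hij]
    · simp [hB, hja, Ne.symm hja, Ne.symm hij]
    · simp [h4, hja, Ne.symm hia]
    · intro g hg1 hg2
      simp only [Finset.mem_insert, not_or] at hg1
      refine ⟨nb g hg1.2.2 hg1.2.1, ?_⟩
      by_cases hg : g = (a, j)
      · subst hg
        refine ⟨(i, j), ?_, ?_, Or.inl ⟨Equiv.swap a i * Equiv.swap i j, ?_⟩⟩
        · simp [hB, hia, hij, Ne.symm hij]
        · simp [h5, hia, hja]
        · intro k
          simp only [Finset.mem_insert, hB, Equiv.Perm.mul_apply, Equiv.swap_apply_def, Prod.mk.injEq]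
          grind
      · refine ⟨(a, j), ?_, ?_, Or.inl ⟨Equiv.swap a j, ?_⟩⟩
        · simp [hB, hja, Ne.symm hja, Ne.symm hij]
        · simp [h4, hja, Ne.symm hia, Ne.symm hg]
        · intro k
          simp only [Finset.mem_insert, hB, Equiv.swap_apply_def, Prod.mk.injEq]
          grind
  · refine ⟨(i, a), ?_, ?_, Or.inl ⟨Equiv.swap a i, ?_⟩⟩
    · simp [hB, hia, Ne.symm hia]
    · simp [h2, hia, Ne.symm hc]
    · intro k
      simp only [Finset.mem_insert, hB, Equiv.swap_apply_def, Prod.mk.injEq]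
      grind

lemma choose_ij {E0 : Finset (Fin m × Fin m)} {a : Fin m} (hm : 4 ≤ m) (hE : E0.card + 2 = m)
    (hu : ∀ e ∈ E0, ∀ e' ∈ E0, (e.1 = a ∨ e.2 = a) → (e'.1 = a ∨ e'.2 = a) → e = e') :
    ∃ i j, i ≠ a ∧ j ≠ a ∧ i ≠ j ∧ (a, i) ∉ E0 ∧ (i, a) ∉ E0 ∧ (j, a) ∉ E0 ∧ (a, j) ∉ E0 ∧
      (i, j) ∉ E0 := by
  classical
  set T := E0.filter fun e => e.1 = a ∨ e.2 = a with hT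
  have hTc : T.card ≤ 1 := by
    rw [Finset.card_le_one]
    intro e he e' he'
    simp only [hT, Finset.mem_filter] at he he'
    exact hu e he.1 e' he'.1 he.2 he'.2
  set K := Finset.univ.filter fun i => i ≠ a ∧ (a, i) ∉ E0 ∧ (i, a) ∉ E0 with hK
  have hKc : m ≤ K.card + 1 + T.card := by
    have hsub : (Finset.univ : Finset (Fin m)) ⊆ K ∪ {a} ∪ T.image fun e => if e.1 = a then e.2 else e.1 := by
      intro i _
      by_cases hi : i ∈ K
      · simp [hi]
      · by_cases hia : i = a
        · simp [hia]
        · simp only [hK, Finset.mem_filter, Finset.mem_univ, true_and] at hi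
          have : (a, i) ∈ E0 ∨ (i, a) ∈ E0 := by tauto
          rw [Finset.mem_union]
          right
          rw [Finset.mem_image]
          rcases this with h | h
          · exact ⟨(a, i), by simp [hT, h], by simp⟩
          · exact ⟨(i, a), by simp [hT, h], by simp [hia]⟩
    have h1 := Finset.card_le_card hsub
    have h2 := Finset.card_union_le (K ∪ {a}) (T.image fun e => if e.1 = a then e.2 else e.1)
    have h3 := Finset.card_union_le K {a}
    have h4 := Finset.card_image_le (s := T) (f := fun e => if e.1 = a then e.2 else e.1)
    simp only [Finset.card_univ, Fintype.card_fin, Finset.card_singleton] at h1 h3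
    omega
  by_contra hcon
  have hsub : K.offDiag ⊆ E0 \ T := by
    rintro ⟨i, j⟩ hij
    simp only [Finset.mem_offDiag, hK, Finset.mem_filter, Finset.mem_univ, true_and] at hij
    simp only [Finset.mem_sdiff, hT, Finset.mem_filter]
    obtain ⟨⟨h1, h2, h3⟩, ⟨h4, h5, h6⟩, h7⟩ := hij
    refine ⟨?_, by tauto⟩
    by_contra h8
    exact hcon ⟨i, j, h1, h4, h7, h2, h3, h6, h5, h8⟩
  have h1 := Finset.card_le_card hsub
  rw [Finset.offDiag_card, Finset.card_sdiff_of_subset (show T ⊆ E0 from Finset.filter_subset _ _)] at h1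
  have hTE : T.card ≤ E0.card := Finset.card_le_card (Finset.filter_subset _ _)
  have hk2 : 2 ≤ K.card := by omega
  have : 2 * K.card ≤ K.card * K.card := Nat.mul_le_mul_right _ hk2
  omega

lemma endgame2a {B E0 : Finset (Fin m × Fin m)} {a : Fin m} (hm : 4 ≤ m) (hE : E0.card + 2 = m)
    (hB : ∀ e, e ∈ B ↔ e.1 ≠ a ∧ e.2 = e.1) (haa : (a, a) ∉ E0)
    (hu : ∀ e ∈ E0, ∀ e' ∈ E0, (e.1 = a ∨ e.2 = a) → (e'.1 = a ∨ e'.2 = a) → e = e')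
    (hcond : (∃ e ∈ E0, ∃ e' ∈ E0, e ≠ e' ∧ (e.1 = e'.1 ∨ e.2 = e'.2)) ∨ (∃ e ∈ E0, e.2 = a) ∨
      (∃ c, c ≠ a ∧ ∀ e ∈ E0, e.1 ≠ a ∧ e.2 ≠ a ∧ e.1 ≠ c ∧ e.2 ≠ c)) :
    W HasPM 3 B (insert (a, a) E0) := by
  rcases hcond with h | h | ⟨c, hca, h⟩
  · obtain ⟨i, j, hia, hja, hij, h1, h2, h3, h4, h5⟩ := choose_ij hm hE hu
    refine endgame1 hB hia hja hij h1 h2 h3 h4 h5 ?_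
    rintro g _ _ ⟨π, hπ⟩
    obtain ⟨hf, -⟩ := pm_forced hE hia π hπ
    obtain ⟨e, he, e', he', hne, hh⟩ := h
    have h6 := hf e he
    have h7 := hf e' he'
    apply hne
    rcases hh with hh | hh
    · exact Prod.ext hh (by rw [h6, h7, hh])
    · rw [h6, h7] at hh
      have := π.injective hh
      exact Prod.ext this (by rw [h6, h7, this])
  · obtain ⟨i, j, hia, hja, hij, h1, h2, h3, h4, h5⟩ := choose_ij hm hE hu
    refine endgame1 hB hia hja hij h1 h2 h3 h4 h5 ?_
    rintro g _ _ ⟨π, hπ⟩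
    obtain ⟨hf, hf2⟩ := pm_forced hE hia π hπ
    obtain ⟨⟨x, y⟩, he, hy⟩ := h
    simp only at hy
    subst hy
    have h6 := hf _ he
    simp only at h6
    rcases hf2 with h7 | h7
    · have := π.injective (h6.symm.trans h7.symm)
      subst this; exact haa he
    · have := π.injective (h6.symm.trans h7.symm)
      subst this; exact h2 he
  · obtain ⟨j, hj⟩ : ∃ j : Fin m, j ∉ ({a, c} : Finset (Fin m)) := by
      by_contra hcon
      push Not at hcon
      have h1 := Finset.card_le_card (fun x _ => hcon x : (Finset.univ : Finset (Fin m)) ⊆ {a, c})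
      have h2 := Finset.card_le_two (a := a) (b := c)
      simp only [Finset.card_univ, Fintype.card_fin] at h1
      omega
    simp only [Finset.mem_insert, Finset.mem_singleton, not_or] at hj
    refine endgame1 hB hca hj.1 (Ne.symm hj.2) ?_ ?_ ?_ ?_ ?_ ?_
    · intro h'; exact (h _ h').1 rfl
    · intro h'; exact (h _ h').2.1 rfl
    · intro h'; exact (h _ h').2.1 rfl
    · intro h'; exact (h _ h').1 rfl
    · intro h'; exact (h _ h').2.2.1 rfl
    · rintro ⟨g1, g2⟩ hgB hg ⟨π, hπ⟩
      obtain ⟨-, hf2⟩ := pm_forced hE hca π hπ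
      have hh1 : ∀ x y, (x, y) ∈ E0 → x ≠ a ∧ y ≠ a ∧ x ≠ c ∧ y ≠ c := fun x y hxy => h _ hxy
      have ha := hπ a
      have hc := hπ c
      have hi := hπ (π.symm c)
      rw [Equiv.apply_symm_apply] at hi
      rw [hB] at hgB
      simp only [Finset.mem_insert, Prod.mk.injEq] at ha hc hi
      simp only [ne_eq, Prod.mk.injEq] at hg hgB
      have inj1 : π a = π c → a = c := fun hx => π.injective hx
      have e1 : π.symm c = a → π a = c := fun hx => by rw [← hx, Equiv.apply_symm_apply]
      have e2 : π.symm c = c → π c = c := fun hx => by conv_lhs => rw [← hx, Equiv.apply_symm_apply]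
      grind

lemma HasPM.swap_iff (S : Finset (Fin m × Fin m)) :
    HasPM (S.map (Equiv.prodComm (Fin m) (Fin m)).toEmbedding) ↔ HasPM S := by
  have key : ∀ x y : Fin m, (x, y) ∈ S.map (Equiv.prodComm (Fin m) (Fin m)).toEmbedding ↔ (y, x) ∈ S := by
    intro x y; simp [Finset.mem_map_equiv]
  constructor
  · rintro ⟨π, h⟩
    refine ⟨π.symm, fun i => ?_⟩
    have := (key _ _).1 (h (π.symm i))
    rwa [Equiv.apply_symm_apply] at this
  · rintro ⟨π, h⟩
    refine ⟨π.symm, fun i => (key _ _).2 ?_⟩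
    have := h (π.symm i)
    rwa [Equiv.apply_symm_apply] at this

lemma endgame2 {B E0 : Finset (Fin m × Fin m)} {a : Fin m} (hm : 4 ≤ m) (hE : E0.card + 2 = m)
    (hB : ∀ e, e ∈ B ↔ e.1 ≠ a ∧ e.2 = e.1) (haa : (a, a) ∉ E0)
    (hu : ∀ e ∈ E0, ∀ e' ∈ E0, (e.1 = a ∨ e.2 = a) → (e'.1 = a ∨ e'.2 = a) → e = e')
    (hcond : (∃ e ∈ E0, ∃ e' ∈ E0, e ≠ e' ∧ (e.1 = e'.1 ∨ e.2 = e'.2)) ∨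
      (∃ e ∈ E0, e.1 = a ∨ e.2 = a) ∨
      (∃ c, c ≠ a ∧ ∀ e ∈ E0, e.1 ≠ a ∧ e.2 ≠ a ∧ e.1 ≠ c ∧ e.2 ≠ c)) :
    W HasPM 3 B (insert (a, a) E0) := by
  rcases hcond with h | ⟨e, he, h | h⟩ | h
  · exact endgame2a hm hE hB haa hu (Or.inl h)
  · apply W_equiv HasPM (Equiv.prodComm (Fin m) (Fin m)) HasPM.swap_iff
    have key : ∀ x y : Fin m,
        (x, y) ∈ E0.map (Equiv.prodComm (Fin m) (Fin m)).toEmbedding ↔ (y, x) ∈ E0 := by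
      intro x y; simp [Finset.mem_map_equiv]
    rw [Finset.map_insert]
    refine endgame2a (a := a) hm ?_ ?_ ?_ ?_ (Or.inr (Or.inl ⟨(e.2, e.1), ?_, h⟩))
    · rw [Finset.card_map]; exact hE
    · rintro ⟨x, y⟩
      rw [Finset.mem_map_equiv, hB]
      simp only [Equiv.prodComm_symm, Equiv.prodComm_apply, Prod.swap_prod_mk]
      grind
    · rw [key]; exact haa
    · rintro ⟨x, y⟩ h1 ⟨z, w⟩ h2 h3 h4
      rw [key] at h1 h2
      have := hu _ h1 _ h2 h3.symm h4.symm
      simp only [Prod.mk.injEq] at this ⊢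
      exact this.symm
    · rw [key]; exact he
  · exact endgame2a hm hE hB haa hu (Or.inr (Or.inl ⟨e, he, h⟩))
  · exact endgame2a hm hE hB haa hu (Or.inr (Or.inr h))


/-- Relabelling the columns by `π`. -/
def colEquiv (π : Equiv.Perm (Fin m)) : Fin m × Fin m ≃ Fin m × Fin m :=
  Equiv.prodCongr (Equiv.refl _) π.symm

lemma mem_map_col (π : Equiv.Perm (Fin m)) (S : Finset (Fin m × Fin m)) (x y : Fin m) :
    (x, y) ∈ S.map (colEquiv π).toEmbedding ↔ (x, π y) ∈ S := by
  rw [Finset.mem_map_equiv]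
  simp [colEquiv]

lemma HasPM.col_iff (π : Equiv.Perm (Fin m)) (S : Finset (Fin m × Fin m)) :
    HasPM (S.map (colEquiv π).toEmbedding) ↔ HasPM S := by
  constructor
  · rintro ⟨ρ, h⟩
    exact ⟨ρ.trans π, fun i => (mem_map_col π S i (ρ i)).1 (h i)⟩
  · rintro ⟨ρ, h⟩
    refine ⟨ρ.trans π.symm, fun i => (mem_map_col _ _ _ _).2 ?_⟩
    simpa using h i

/-- The endgame after relabelling. -/
lemma endgame3 {B E0 : Finset (Fin m × Fin m)} {a : Fin m} (π : Equiv.Perm (Fin m))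
    (hm : 4 ≤ m) (hE : E0.card + 2 = m)
    (hB : ∀ e, e ∈ B ↔ e.1 ≠ a ∧ e.2 = π e.1) (haa : (a, π a) ∉ E0)
    (hu : ∀ e ∈ E0, ∀ e' ∈ E0, (e.1 = a ∨ e.2 = π a) → (e'.1 = a ∨ e'.2 = π a) → e = e')
    (hcond : (∃ e ∈ E0, ∃ e' ∈ E0, e ≠ e' ∧ (e.1 = e'.1 ∨ e.2 = e'.2)) ∨
      (∃ e ∈ E0, e.1 = a ∨ e.2 = π a) ∨
      (∃ c, c ≠ a ∧ ∀ e ∈ E0, e.1 ≠ a ∧ e.2 ≠ π a ∧ e.1 ≠ c ∧ e.2 ≠ π c)) :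
    W HasPM 3 B (insert (a, π a) E0) := by
  apply W_equiv HasPM (colEquiv π) (HasPM.col_iff π)
  have hins : (insert (a, π a) E0).map (colEquiv π).toEmbedding =
      insert (a, a) (E0.map (colEquiv π).toEmbedding) := by
    rw [Finset.map_insert]
    simp [colEquiv]
  rw [hins]
  have lift : ∀ x y, (x, y) ∈ E0 → (x, π.symm y) ∈ E0.map (colEquiv π).toEmbedding := by
    intro x y h
    rw [mem_map_col]
    simpa using h
  refine endgame2 hm ?_ ?_ ?_ ?_ ?_
  · rw [Finset.card_map]; exact hE
  · rintro ⟨x, y⟩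
    rw [mem_map_col, hB]
    simp
  · rw [mem_map_col]; exact haa
  · rintro ⟨x, y⟩ h1 ⟨z, w⟩ h2 h3 h4
    rw [mem_map_col] at h1 h2
    have := hu _ h1 _ h2 (by simpa using h3) (by simpa using h4)
    simpa using this
  · rcases hcond with ⟨⟨x, y⟩, h1, ⟨z, w⟩, h2, h3, h4⟩ | ⟨⟨x, y⟩, h1, h2⟩ | ⟨c, hc, h⟩
    · refine Or.inl ⟨_, lift _ _ h1, _, lift _ _ h2, ?_, ?_⟩
      · simpa using h3
      · simpa using h4
    · refine Or.inr (Or.inl ⟨_, lift _ _ h1, ?_⟩)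
      simpa [Equiv.symm_apply_eq] using h2
    · refine Or.inr (Or.inr ⟨c, hc, ?_⟩)
      rintro ⟨x, y⟩ hxy
      rw [mem_map_col] at hxy
      simpa using h _ hxy

lemma step2 {X Y : Finset (Fin m)} {π : Equiv.Perm (Fin m)}
    {B R : Finset (Fin m × Fin m)} {e0 : Fin m × Fin m}
    (hX : 2 ≤ X.card) (hY : ∀ i, π i ∈ Y ↔ i ∈ X) (hB : ∀ e, e ∈ B ↔ e.1 ∉ X ∧ e.2 = π e.1)
    (hc : Clean X Y (R.erase e0)) :
    ∃ x ∈ X, ∃ π' : Equiv.Perm (Fin m), (x, π' x) ∉ R ∧ (x, π' x) ∉ B ∧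
      Clean (X.erase x) (Y.erase (π' x)) R ∧ (∀ i, π' i ∈ Y ↔ i ∈ X) ∧
      (∀ i, π' i ∈ Y.erase (π' x) ↔ i ∈ X.erase x) ∧
      (∀ e, e ∈ insert (x, π' x) B ↔ e.1 ∉ X.erase x ∧ e.2 = π' e.1) ∧ Cond x X Y (π' x) R := by
  have hYX : Y = X.image π := by
    ext y
    rw [Finset.mem_image]
    constructor
    · intro hy
      exact ⟨π.symm y, by rw [← hY]; simpa using hy, by simp⟩
    · rintro ⟨i, hi, rfl⟩
      exact (hY i).2 hi
  have hYc : 2 ≤ Y.card := by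
    rw [hYX, Finset.card_image_of_injective _ π.injective]; exact hX
  obtain ⟨x, hx, y, hy, h1, h2, h3⟩ := step X Y R e0 hX hYc hc
  obtain ⟨z, rfl⟩ := π.surjective y
  have hz : z ∈ X := (hY z).1 hy
  have hx' : (π * Equiv.swap x z) x = π z := by simp
  refine ⟨x, hx, π * Equiv.swap x z, ?_⟩
  have hall : ∀ i, (π * Equiv.swap x z) i ∈ Y ↔ i ∈ X := by
    intro i
    rw [Equiv.Perm.mul_apply, hY, Equiv.swap_apply_def]
    split_ifs <;> simp_all
  refine ⟨?_, ?_, ?_, hall, ?_, ?_, ?_⟩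
  · rwa [hx']
  · simp [hB, hx]
  · rwa [hx']
  · intro i
    rw [Finset.mem_erase, Finset.mem_erase, hall, (π * Equiv.swap x z).injective.ne_iff]
  · rintro ⟨i, j⟩
    rw [hx', Finset.mem_insert, hB]
    simp only [Prod.mk.injEq, Finset.mem_erase, Equiv.Perm.mul_apply, Equiv.swap_apply_def]
    grind
  · rwa [hx']

lemma phase1 (hm : 4 ≤ m) (r : ℕ) : ∀ (X Y : Finset (Fin m)) (π : Equiv.Perm (Fin m))
    (B R : Finset (Fin m × Fin m)) (e0 : Fin m × Fin m),
    X.card = r + 2 → (∀ i, π i ∈ Y ↔ i ∈ X) → (∀ e, e ∈ B ↔ e.1 ∉ X ∧ e.2 = π e.1) →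
    R.card + X.card = m → Clean X Y (R.erase e0) → W HasPM (r + 4) B R := by
  induction r with
  | zero =>
    intro X Y π B R e0 hX hY hB hR hc
    obtain ⟨x, hx, π', h1, h2, h3, h4, h5, h6, h7⟩ := step2 hX.ge hY hB hc
    have hX' : (X.erase x).card = 1 := by rw [Finset.card_erase_of_mem hx]; omega
    obtain ⟨a, ha⟩ := Finset.card_eq_one.1 hX'
    have hYa : Y.erase (π' x) = {π' a} := by
      ext y
      obtain ⟨i, rfl⟩ := π'.surjective y
      rw [h5, ha]
      simp
    have haX : a ≠ x ∧ a ∈ X := by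
      rw [← Finset.mem_erase, ha]; simp
    have hR2 : (a, π' a) ∉ R := by
      intro h
      apply h3.1 _ h
      rw [ha, hYa]; simp
    rw [ha] at h6
    refine ⟨(x, π' x), h2, h1, Or.inr ⟨⟨(a, π' a), ?_, hR2⟩, ?_⟩⟩
    · rw [h6]; simp
    · intro e' he1 he2
      refine ⟨fun h => ?_, ?_⟩
      · have := h.card_le'
        rw [Finset.card_insert_of_notMem he2] at this
        omega
      · by_cases he : e' = (a, π' a)
        · subst he
          apply endgame3 π' hm (by omega) _ hR2
          · have := h3.2
            rw [ha, hYa] at this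
            simpa using this
          · rcases h7 with h7 | h7 | h7
            · rw [ha, hYa] at h7
              right; left
              simpa using h7
            · right; right
              refine ⟨x, haX.1.symm, fun e he => ?_⟩
              obtain ⟨h8, h9⟩ := h7 e he
              refine ⟨?_, ?_, ?_, ?_⟩
              · rintro h; rw [h] at h8; exact h8 haX.2
              · rintro h; rw [h, h4] at h9; exact h9 haX.2
              · rintro h; rw [h] at h8; exact h8 hx
              · rintro h; rw [h, h4] at h9; exact h9 hx
            · exact Or.inl h7
          · intro e
            rw [h6]; simp
        · refine W_mono' HasPM (s := 1) (t := 3) (by omega) ?_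
          refine ⟨(a, π' a), ?_, ?_, Or.inl ⟨π', fun i => ?_⟩⟩
          · rw [h6]; simp
          · simp [hR2, Ne.symm he]
          · rw [Finset.mem_insert, h6]
            by_cases hi : i = a <;> simp [hi]
  | succ r ih =>
    intro X Y π B R e0 hX hY hB hR hc
    obtain ⟨x, hx, π', h1, h2, h3, h4, h5, h6, h7⟩ := step2 (by omega) hY hB hc
    have hX' : (X.erase x).card = r + 2 := by rw [Finset.card_erase_of_mem hx]; omega
    obtain ⟨a, ha⟩ : (X.erase x).Nonempty := by
      rw [← Finset.card_pos]; omega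
    have hR2 : (a, π' a) ∉ R := fun h => h3.1 _ h ⟨ha, (h5 a).2 ha⟩
    refine ⟨(x, π' x), h2, h1, Or.inr ⟨⟨(a, π' a), ?_, hR2⟩, ?_⟩⟩
    · rw [h6]; simp only [not_and]; intro h; exact absurd ha h
    · intro e' he1 he2
      refine ⟨fun h => ?_, ?_⟩
      · have := h.card_le'
        rw [Finset.card_insert_of_notMem he2] at this
        omega
      · refine ih (X.erase x) (Y.erase (π' x)) π' _ _ e' hX' h5 h6 ?_ ?_
        · rw [Finset.card_insert_of_notMem he2]; omega
        · rwa [Finset.erase_insert he2]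

lemma main_wins (hm : 4 ≤ m) : W (HasM (n := m) m) (m + 2) ∅ ∅ := by
  rw [hasM_eq]
  obtain ⟨r, rfl⟩ : ∃ r, m = r + 2 := ⟨m - 2, by omega⟩
  refine phase1 hm r Finset.univ Finset.univ 1 ∅ ∅ (0, 0) (by simp) (by simp) (by simp) (by simp) ?_
  constructor <;> simp

end Main

/-- For every positive integer `m`, the bipartite achievement number of the matching
`mK₂` satisfies `ba(mK₂) = m + 1` if `m = 2` or `m = 3`, and `ba(mK₂) = m` if `m = 1`
or `m ≥ 4`: the least `n` for which Alice has a winning strategy in `(mK₂, K_{n,n}, +)`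
is that value. -/
theorem stmt2 (m : ℕ) (hm : 1 ≤ m) :
    IsLeast {n : ℕ | AliceWins (matching m) (completeBipartiteGraph (Fin n) (Fin n))}
      (if m = 2 ∨ m = 3 then m + 1 else m) := by
  constructor
  · split_ifs with h
    · rcases h with rfl | rfl
      · refine greedy_wins (by norm_num) ?_ ?_
        · intro k hk; interval_cases k <;> norm_num
        · intro k hk; omega
      · refine greedy_wins (by norm_num) ?_ ?_
        · intro k hk; interval_cases k <;> norm_num
        · intro k hk; omega
    · by_cases h1 : m = 1
      · subst h1
        refine greedy_wins (by norm_num) ?_ ?_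
        · intro k hk; interval_cases k; norm_num
        · intro k hk; omega
      · exact aliceWins_of_W m (m + 2) hm (main_wins (by omega))
  · intro n hn
    have hn' : AliceWins (matching m) (completeBipartiteGraph (Fin n) (Fin n)) := hn
    have h0 : m ≤ n := by
      by_contra hlt
      exact not_aliceWins_of_lt (by omega) hn'
    split_ifs with h
    · rcases h with rfl | rfl
      · by_contra hlt
        have : n = 2 := by omega
        subst this
        exact not_win2 hn'
      · by_contra hlt
        have : n = 3 := by omega
        subst this
        exact not_win3 hn'
    · exact h0
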